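/- arXiv:2006.15867 — 2 statements merged into one kernel-verified Lean document; each statement's English description precedes it below -/
import Mathlib

section
/- Every block TBT-matrix T satisfies the matrix identity A₁T − TA₁^* = i(M₁₁M₂₁ + M₃₁M₄₁), where ^* denotes conjugate transpose. -/
open Matrix Kronecker BigOperators

noncomputable section

namespace TBT

/-- The entries `a_r` of the matrices `𝒜_p`. -/
def aEnt (r : ℤ) : ℂ := if r < 0 then 0 else if r = 0 then Complex.I / 2 else Complex.I

/-- The `n × n` matrix `𝒜 = {a_{j-ℓ}}`. -/
def calA (n : ℕ) : Matrix (Fin n) (Fin n) ℂ :=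
  Matrix.of fun j ℓ => aEnt (((j : ℕ) : ℤ) - ((ℓ : ℕ) : ℤ))

/-- The index type of the `m × m` matrices, `m = m₁ m₂ m₃`. -/
abbrev Idx (m₁ m₂ m₃ : ℕ) := (Fin m₁ × Fin m₂) × Fin m₃

/-- `A₁ = 𝒜₁ ⊗ I_{m₂} ⊗ I_{m₃}`. -/
def A1 (m₁ m₂ m₃ : ℕ) : Matrix (Idx m₁ m₂ m₃) (Idx m₁ m₂ m₃) ℂ :=
  (calA m₁ ⊗ₖ (1 : Matrix (Fin m₂) (Fin m₂) ℂ)) ⊗ₖ (1 : Matrix (Fin m₃) (Fin m₃) ℂ)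

/-- `A₂ = I_{m₁} ⊗ 𝒜₂ ⊗ I_{m₃}`. -/
def A2 (m₁ m₂ m₃ : ℕ) : Matrix (Idx m₁ m₂ m₃) (Idx m₁ m₂ m₃) ℂ :=
  ((1 : Matrix (Fin m₁) (Fin m₁) ℂ) ⊗ₖ calA m₂) ⊗ₖ (1 : Matrix (Fin m₃) (Fin m₃) ℂ)

/-- `A₃ = I_{m₁} ⊗ I_{m₂} ⊗ 𝒜₃`. -/
def A3 (m₁ m₂ m₃ : ℕ) : Matrix (Idx m₁ m₂ m₃) (Idx m₁ m₂ m₃) ℂ :=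
  ((1 : Matrix (Fin m₁) (Fin m₁) ℂ) ⊗ₖ (1 : Matrix (Fin m₂) (Fin m₂) ℂ)) ⊗ₖ calA m₃

/-- The block TBT-matrix `T = {𝒯_{i-k}}`, `𝒯_r = {t^{(r)}_{i-k}}`, built from the
data `t : ℤ → ℤ → Matrix (Fin m₃) (Fin m₃) ℂ` of its `m₃ × m₃` blocks. -/
def Tmat (m₁ m₂ m₃ : ℕ) (t : ℤ → ℤ → Matrix (Fin m₃) (Fin m₃) ℂ) :
    Matrix (Idx m₁ m₂ m₃) (Idx m₁ m₂ m₃) ℂ :=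
  Matrix.of fun x y =>
    t (((x.1.1 : ℕ) : ℤ) - ((y.1.1 : ℕ) : ℤ)) (((x.1.2 : ℕ) : ℤ) - ((y.1.2 : ℕ) : ℤ)) x.2 y.2

/-- The Toeplitz blocks `𝒯_r = {t^{(r)}_{i-k}}` of a block TBT-matrix. -/
def calT (m₂ m₃ : ℕ) (t : ℤ → ℤ → Matrix (Fin m₃) (Fin m₃) ℂ) (r : ℤ) :
    Matrix (Fin m₂ × Fin m₃) (Fin m₂ × Fin m₃) ℂ :=
  Matrix.of fun x y => t r (((x.1 : ℕ) : ℤ) - ((y.1 : ℕ) : ℤ)) x.2 y.2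

/-- `M₁₁ = col [M₁₁⁽¹⁾ … M₁₁⁽ᵐ¹⁾]`, `M₁₁⁽ⁱ⁾ = (1/2)𝒯₀ + Σ_{s=1}^{i-1} 𝒯_s`. -/
def M11 (m₁ m₂ m₃ : ℕ) (t : ℤ → ℤ → Matrix (Fin m₃) (Fin m₃) ℂ) :
    Matrix (Idx m₁ m₂ m₃) (Fin m₂ × Fin m₃) ℂ :=
  Matrix.of fun x y =>
    ((2 : ℂ)⁻¹ • calT m₂ m₃ t 0 +
      ∑ s ∈ Finset.range (x.1.1 : ℕ), calT m₂ m₃ t ((s : ℤ) + 1)) (x.1.2, x.2) y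

/-- `M₂₁ = 1_{m₁}^* ⊗ I_{m₂ m₃}`. -/
def M21 (m₁ m₂ m₃ : ℕ) : Matrix (Fin m₂ × Fin m₃) (Idx m₁ m₂ m₃) ℂ :=
  Matrix.of fun y x => if y.1 = x.1.2 ∧ y.2 = x.2 then 1 else 0

/-- `M₃₁ = M₂₁^*`. -/
def M31 (m₁ m₂ m₃ : ℕ) : Matrix (Idx m₁ m₂ m₃) (Fin m₂ × Fin m₃) ℂ := (M21 m₁ m₂ m₃)ᴴ

/-- `M₄₁ = [M₄₁⁽¹⁾ … M₄₁⁽ᵐ¹⁾]`, `M₄₁⁽ᵏ⁾ = (1/2)𝒯₀ + Σ_{s=1}^{k-1} 𝒯_{-s}`. -/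
def M41 (m₁ m₂ m₃ : ℕ) (t : ℤ → ℤ → Matrix (Fin m₃) (Fin m₃) ℂ) :
    Matrix (Fin m₂ × Fin m₃) (Idx m₁ m₂ m₃) ℂ :=
  Matrix.of fun y x =>
    ((2 : ℂ)⁻¹ • calT m₂ m₃ t 0 +
      ∑ s ∈ Finset.range (x.1.1 : ℕ), calT m₂ m₃ t (-((s : ℤ) + 1))) y (x.1.2, x.2)

/-- The blocks `M₁₂⁽ʳ⁾ = col [(1/2)t₀⁽ʳ⁾, (1/2)t₀⁽ʳ⁾ + t₁⁽ʳ⁾, …]`. -/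
def M12blk (m₂ m₃ : ℕ) (t : ℤ → ℤ → Matrix (Fin m₃) (Fin m₃) ℂ) (r : ℤ) :
    Matrix (Fin m₂ × Fin m₃) (Fin m₃) ℂ :=
  Matrix.of fun x l =>
    ((2 : ℂ)⁻¹ • t r 0 + ∑ j ∈ Finset.range (x.1 : ℕ), t r ((j : ℤ) + 1)) x.2 l

/-- `M₁₂ = {M₁₂^{(i-k)}}_{i,k=1}^{m₁}`. -/
def M12 (m₁ m₂ m₃ : ℕ) (t : ℤ → ℤ → Matrix (Fin m₃) (Fin m₃) ℂ) :
    Matrix (Idx m₁ m₂ m₃) (Fin m₁ × Fin m₃) ℂ :=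
  Matrix.of fun x y => M12blk m₂ m₃ t (((x.1.1 : ℕ) : ℤ) - ((y.1 : ℕ) : ℤ)) (x.1.2, x.2) y.2

/-- `M₂₂ = I_{m₁} ⊗ 1_{m₂}^* ⊗ I_{m₃}`. -/
def M22 (m₁ m₂ m₃ : ℕ) : Matrix (Fin m₁ × Fin m₃) (Idx m₁ m₂ m₃) ℂ :=
  Matrix.of fun y x => if y.1 = x.1.1 ∧ y.2 = x.2 then 1 else 0

/-- `M₃₂ = M₂₂^*`. -/
def M32 (m₁ m₂ m₃ : ℕ) : Matrix (Idx m₁ m₂ m₃) (Fin m₁ × Fin m₃) ℂ := (M22 m₁ m₂ m₃)ᴴ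

/-- The blocks `M₄₂⁽ʳ⁾ = [(1/2)t₀⁽ʳ⁾, (1/2)t₀⁽ʳ⁾ + t₋₁⁽ʳ⁾, …]`. -/
def M42blk (m₂ m₃ : ℕ) (t : ℤ → ℤ → Matrix (Fin m₃) (Fin m₃) ℂ) (r : ℤ) :
    Matrix (Fin m₃) (Fin m₂ × Fin m₃) ℂ :=
  Matrix.of fun l x =>
    ((2 : ℂ)⁻¹ • t r 0 + ∑ j ∈ Finset.range (x.1 : ℕ), t r (-((j : ℤ) + 1))) l x.2

/-- `M₄₂ = {M₄₂^{(i-k)}}_{i,k=1}^{m₁}`. -/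
def M42 (m₁ m₂ m₃ : ℕ) (t : ℤ → ℤ → Matrix (Fin m₃) (Fin m₃) ℂ) :
    Matrix (Fin m₁ × Fin m₃) (Idx m₁ m₂ m₃) ℂ :=
  Matrix.of fun y x => M42blk m₂ m₃ t (((y.1 : ℕ) : ℤ) - ((x.1.1 : ℕ) : ℤ)) y.2 (x.1.2, x.2)

/-- `Π₁ = [M₁₁ M₃₁]`. -/
def Pi1 (m₁ m₂ m₃ : ℕ) (t : ℤ → ℤ → Matrix (Fin m₃) (Fin m₃) ℂ) :
    Matrix (Idx m₁ m₂ m₃) ((Fin m₂ × Fin m₃) ⊕ (Fin m₂ × Fin m₃)) ℂ :=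
  Matrix.fromCols (M11 m₁ m₂ m₃ t) (M31 m₁ m₂ m₃)

/-- `Π₂ = [M₁₂ M₃₂]`. -/
def Pi2 (m₁ m₂ m₃ : ℕ) (t : ℤ → ℤ → Matrix (Fin m₃) (Fin m₃) ℂ) :
    Matrix (Idx m₁ m₂ m₃) ((Fin m₁ × Fin m₃) ⊕ (Fin m₁ × Fin m₃)) ℂ :=
  Matrix.fromCols (M12 m₁ m₂ m₃ t) (M32 m₁ m₂ m₃)

/-- `Π̂₁ = col [M₂₁; M₄₁]`. -/
def Pihat1 (m₁ m₂ m₃ : ℕ) (t : ℤ → ℤ → Matrix (Fin m₃) (Fin m₃) ℂ) :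
    Matrix ((Fin m₂ × Fin m₃) ⊕ (Fin m₂ × Fin m₃)) (Idx m₁ m₂ m₃) ℂ :=
  Matrix.fromRows (M21 m₁ m₂ m₃) (M41 m₁ m₂ m₃ t)

/-- `Π̂₂ = col [M₂₂; M₄₂]`. -/
def Pihat2 (m₁ m₂ m₃ : ℕ) (t : ℤ → ℤ → Matrix (Fin m₃) (Fin m₃) ℂ) :
    Matrix ((Fin m₁ × Fin m₃) ⊕ (Fin m₁ × Fin m₃)) (Idx m₁ m₂ m₃) ℂ :=
  Matrix.fromRows (M22 m₁ m₂ m₃) (M42 m₁ m₂ m₃ t)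

/-- `Γ₁ = T⁻¹ Π₁`. -/
def Gamma1 (m₁ m₂ m₃ : ℕ) (t : ℤ → ℤ → Matrix (Fin m₃) (Fin m₃) ℂ) :
    Matrix (Idx m₁ m₂ m₃) ((Fin m₂ × Fin m₃) ⊕ (Fin m₂ × Fin m₃)) ℂ :=
  (Tmat m₁ m₂ m₃ t)⁻¹ * Pi1 m₁ m₂ m₃ t

/-- `Γ₂ = T⁻¹ Π₂`. -/
def Gamma2 (m₁ m₂ m₃ : ℕ) (t : ℤ → ℤ → Matrix (Fin m₃) (Fin m₃) ℂ) :
    Matrix (Idx m₁ m₂ m₃) ((Fin m₁ × Fin m₃) ⊕ (Fin m₁ × Fin m₃)) ℂ :=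
  (Tmat m₁ m₂ m₃ t)⁻¹ * Pi2 m₁ m₂ m₃ t

/-- `Γ̂₁ = Π̂₁ T⁻¹`. -/
def Gammahat1 (m₁ m₂ m₃ : ℕ) (t : ℤ → ℤ → Matrix (Fin m₃) (Fin m₃) ℂ) :
    Matrix ((Fin m₂ × Fin m₃) ⊕ (Fin m₂ × Fin m₃)) (Idx m₁ m₂ m₃) ℂ :=
  Pihat1 m₁ m₂ m₃ t * (Tmat m₁ m₂ m₃ t)⁻¹

/-- `Γ̂₂ = Π̂₂ T⁻¹`. -/
def Gammahat2 (m₁ m₂ m₃ : ℕ) (t : ℤ → ℤ → Matrix (Fin m₃) (Fin m₃) ℂ) :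
    Matrix ((Fin m₁ × Fin m₃) ⊕ (Fin m₁ × Fin m₃)) (Idx m₁ m₂ m₃) ℂ :=
  Pihat2 m₁ m₂ m₃ t * (Tmat m₁ m₂ m₃ t)⁻¹

/-- `ℒ = 1_{m₁m₂} ⊗ I_{m₃}`. -/
def Lmat (m₁ m₂ m₃ : ℕ) : Matrix (Idx m₁ m₂ m₃) (Fin m₃) ℂ :=
  Matrix.of fun x l => if x.2 = l then 1 else 0

/-- `ℒ_p = 1_{m_p} ⊗ I_{m₃}`. -/
def Lp (n m₃ : ℕ) : Matrix (Fin n × Fin m₃) (Fin m₃) ℂ :=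
  Matrix.of fun x l => if x.2 = l then 1 else 0

/-- A row vector `v` Kronecker the identity `I_{m₃}`. -/
def rowKronId {n : Type*} (m₃ : ℕ) (v : n → ℂ) : Matrix (Fin m₃) (n × Fin m₃) ℂ :=
  Matrix.of fun l x => v x.1 * (if l = x.2 then 1 else 0)

/-- A column vector `v` Kronecker the identity `I_{m₃}`. -/
def colKronId {n : Type*} (m₃ : ℕ) (v : n → ℂ) : Matrix (n × Fin m₃) (Fin m₃) ℂ :=
  Matrix.of fun x l => v x.1 * (if x.2 = l then 1 else 0)

/-- `ω(λ,μ) = ℒ^* (A₁^*-μ₁I)⁻¹ (A₂^*-μ₂I)⁻¹ T⁻¹ (A₁-λ₁I)⁻¹ (A₂-λ₂I)⁻¹ ℒ`. -/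
def omegaF (m₁ m₂ m₃ : ℕ) (t : ℤ → ℤ → Matrix (Fin m₃) (Fin m₃) ℂ) (l₁ l₂ mu₁ mu₂ : ℂ) :
    Matrix (Fin m₃) (Fin m₃) ℂ :=
  (Lmat m₁ m₂ m₃)ᴴ * ((A1 m₁ m₂ m₃)ᴴ - mu₁ • 1)⁻¹ * ((A2 m₁ m₂ m₃)ᴴ - mu₂ • 1)⁻¹ *
    (Tmat m₁ m₂ m₃ t)⁻¹ * (A1 m₁ m₂ m₃ - l₁ • 1)⁻¹ * (A2 m₁ m₂ m₃ - l₂ • 1)⁻¹ *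
    Lmat m₁ m₂ m₃

/-- `v₁(μ) = ℒ^* (A₁^*-μ₁I)⁻¹ (A₂^*-μ₂I)⁻¹ Γ₁`. -/
def v1 (m₁ m₂ m₃ : ℕ) (t : ℤ → ℤ → Matrix (Fin m₃) (Fin m₃) ℂ) (mu₁ mu₂ : ℂ) :
    Matrix (Fin m₃) ((Fin m₂ × Fin m₃) ⊕ (Fin m₂ × Fin m₃)) ℂ :=
  (Lmat m₁ m₂ m₃)ᴴ * ((A1 m₁ m₂ m₃)ᴴ - mu₁ • 1)⁻¹ * ((A2 m₁ m₂ m₃)ᴴ - mu₂ • 1)⁻¹ *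
    Gamma1 m₁ m₂ m₃ t

/-- `v₂(μ) = ℒ^* (A₁^*-μ₁I)⁻¹ (A₂^*-μ₂I)⁻¹ Γ₂`. -/
def v2 (m₁ m₂ m₃ : ℕ) (t : ℤ → ℤ → Matrix (Fin m₃) (Fin m₃) ℂ) (mu₁ mu₂ : ℂ) :
    Matrix (Fin m₃) ((Fin m₁ × Fin m₃) ⊕ (Fin m₁ × Fin m₃)) ℂ :=
  (Lmat m₁ m₂ m₃)ᴴ * ((A1 m₁ m₂ m₃)ᴴ - mu₁ • 1)⁻¹ * ((A2 m₁ m₂ m₃)ᴴ - mu₂ • 1)⁻¹ *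
    Gamma2 m₁ m₂ m₃ t

/-- `v̂₁(λ) = Γ̂₁ (A₁-λ₁I)⁻¹ (A₂-λ₂I)⁻¹ ℒ`. -/
def vhat1 (m₁ m₂ m₃ : ℕ) (t : ℤ → ℤ → Matrix (Fin m₃) (Fin m₃) ℂ) (l₁ l₂ : ℂ) :
    Matrix ((Fin m₂ × Fin m₃) ⊕ (Fin m₂ × Fin m₃)) (Fin m₃) ℂ :=
  Gammahat1 m₁ m₂ m₃ t * (A1 m₁ m₂ m₃ - l₁ • 1)⁻¹ * (A2 m₁ m₂ m₃ - l₂ • 1)⁻¹ * Lmat m₁ m₂ m₃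

/-- `v̂₂(λ) = Γ̂₂ (A₁-λ₁I)⁻¹ (A₂-λ₂I)⁻¹ ℒ`. -/
def vhat2 (m₁ m₂ m₃ : ℕ) (t : ℤ → ℤ → Matrix (Fin m₃) (Fin m₃) ℂ) (l₁ l₂ : ℂ) :
    Matrix ((Fin m₁ × Fin m₃) ⊕ (Fin m₁ × Fin m₃)) (Fin m₃) ℂ :=
  Gammahat2 m₁ m₂ m₃ t * (A1 m₁ m₂ m₃ - l₁ • 1)⁻¹ * (A2 m₁ m₂ m₃ - l₂ • 1)⁻¹ * Lmat m₁ m₂ m₃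

/-- `u₁(μ) = v₁(μ) - i (1_{m₂}^* (𝒜₂^*-μ₂I)⁻¹ ⊗ I_{m₃}) [I_{m₂m₃} 0]`. -/
def u1 (m₁ m₂ m₃ : ℕ) (t : ℤ → ℤ → Matrix (Fin m₃) (Fin m₃) ℂ) (mu₁ mu₂ : ℂ) :
    Matrix (Fin m₃) ((Fin m₂ × Fin m₃) ⊕ (Fin m₂ × Fin m₃)) ℂ :=
  v1 m₁ m₂ m₃ t mu₁ mu₂ -
    Complex.I • Matrix.fromCols
      (rowKronId m₃ (Matrix.vecMul (fun _ : Fin m₂ => (1 : ℂ)) (((calA m₂)ᴴ - mu₂ • 1)⁻¹))) 0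

/-- `u₂(μ) = v₂(μ) - i (1_{m₁}^* (𝒜₁^*-μ₁I)⁻¹ ⊗ I_{m₃}) [I_{m₁m₃} 0]`. -/
def u2 (m₁ m₂ m₃ : ℕ) (t : ℤ → ℤ → Matrix (Fin m₃) (Fin m₃) ℂ) (mu₁ mu₂ : ℂ) :
    Matrix (Fin m₃) ((Fin m₁ × Fin m₃) ⊕ (Fin m₁ × Fin m₃)) ℂ :=
  v2 m₁ m₂ m₃ t mu₁ mu₂ -
    Complex.I • Matrix.fromCols
      (rowKronId m₃ (Matrix.vecMul (fun _ : Fin m₁ => (1 : ℂ)) (((calA m₁)ᴴ - mu₁ • 1)⁻¹))) 0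

/-- `û₁(λ) = v̂₁(λ) + i col[0; I_{m₂m₃}] ((𝒜₂-λ₂I)⁻¹ 1_{m₂} ⊗ I_{m₃})`. -/
def uhat1 (m₁ m₂ m₃ : ℕ) (t : ℤ → ℤ → Matrix (Fin m₃) (Fin m₃) ℂ) (l₁ l₂ : ℂ) :
    Matrix ((Fin m₂ × Fin m₃) ⊕ (Fin m₂ × Fin m₃)) (Fin m₃) ℂ :=
  vhat1 m₁ m₂ m₃ t l₁ l₂ +
    Complex.I • Matrix.fromRows 0
      (colKronId m₃ (Matrix.mulVec ((calA m₂ - l₂ • 1)⁻¹) (fun _ : Fin m₂ => (1 : ℂ))))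

/-- `û₂(λ) = v̂₂(λ) + i col[0; I_{m₁m₃}] ((𝒜₁-λ₁I)⁻¹ 1_{m₁} ⊗ I_{m₃})`. -/
def uhat2 (m₁ m₂ m₃ : ℕ) (t : ℤ → ℤ → Matrix (Fin m₃) (Fin m₃) ℂ) (l₁ l₂ : ℂ) :
    Matrix ((Fin m₁ × Fin m₃) ⊕ (Fin m₁ × Fin m₃)) (Fin m₃) ℂ :=
  vhat2 m₁ m₂ m₃ t l₁ l₂ +
    Complex.I • Matrix.fromRows 0
      (colKronId m₃ (Matrix.mulVec ((calA m₁ - l₁ • 1)⁻¹) (fun _ : Fin m₁ => (1 : ℂ))))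

/-- `K₁₁ = col [(1/2)M₄₂⁽⁰⁾, (1/2)M₄₂⁽⁰⁾+M₄₂⁽¹⁾, …]`. -/
def K11 (m₁ m₂ m₃ : ℕ) (t : ℤ → ℤ → Matrix (Fin m₃) (Fin m₃) ℂ) :
    Matrix (Fin m₁ × Fin m₃) (Fin m₂ × Fin m₃) ℂ :=
  Matrix.of fun y x =>
    ((2 : ℂ)⁻¹ • M42blk m₂ m₃ t 0 +
      ∑ j ∈ Finset.range (y.1 : ℕ), M42blk m₂ m₃ t ((j : ℤ) + 1)) y.2 x

/-- `K₁₂ = [(1/2)M₁₂⁽⁰⁾, (1/2)M₁₂⁽⁰⁾+M₁₂⁽⁻¹⁾, …]`. -/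
def K12 (m₁ m₂ m₃ : ℕ) (t : ℤ → ℤ → Matrix (Fin m₃) (Fin m₃) ℂ) :
    Matrix (Fin m₂ × Fin m₃) (Fin m₁ × Fin m₃) ℂ :=
  Matrix.of fun y x =>
    ((2 : ℂ)⁻¹ • M12blk m₂ m₃ t 0 +
      ∑ j ∈ Finset.range (x.1 : ℕ), M12blk m₂ m₃ t (-((j : ℤ) + 1))) y x.2

/-- `K = [(1/2)M₄₂⁽⁰⁾, (1/2)M₄₂⁽⁰⁾+M₄₂⁽⁻¹⁾, …]`. -/
def Kmat (m₁ m₂ m₃ : ℕ) (t : ℤ → ℤ → Matrix (Fin m₃) (Fin m₃) ℂ) :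
    Matrix (Fin m₃) (Idx m₁ m₂ m₃) ℂ :=
  Matrix.of fun l x =>
    ((2 : ℂ)⁻¹ • M42blk m₂ m₃ t 0 +
      ∑ j ∈ Finset.range (x.1.1 : ℕ), M42blk m₂ m₃ t (-((j : ℤ) + 1))) l (x.1.2, x.2)

/-- `N = col [(1/2)M₁₂⁽⁰⁾, (1/2)M₁₂⁽⁰⁾+M₁₂⁽¹⁾, …]`. -/
def Nmat (m₁ m₂ m₃ : ℕ) (t : ℤ → ℤ → Matrix (Fin m₃) (Fin m₃) ℂ) :
    Matrix (Idx m₁ m₂ m₃) (Fin m₃) ℂ :=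
  Matrix.of fun x l =>
    ((2 : ℂ)⁻¹ • M12blk m₂ m₃ t 0 +
      ∑ j ∈ Finset.range (x.1.1 : ℕ), M12blk m₂ m₃ t ((j : ℤ) + 1)) (x.1.2, x.2) l

/-- `diag {(𝒜-zI) ⊗ I_{m₃}, (𝒜-zI) ⊗ I_{m₃}}` (the diagonal blocks `G₁₁`, `G₂₂`). -/
def diagKron (n m₃ : ℕ) (z : ℂ) :
    Matrix ((Fin n × Fin m₃) ⊕ (Fin n × Fin m₃)) ((Fin n × Fin m₃) ⊕ (Fin n × Fin m₃)) ℂ :=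
  Matrix.fromBlocks ((calA n - z • 1) ⊗ₖ (1 : Matrix (Fin m₃) (Fin m₃) ℂ)) 0 0
    ((calA n - z • 1) ⊗ₖ (1 : Matrix (Fin m₃) (Fin m₃) ℂ))

/-- `diag {(𝒜^*-zI) ⊗ I_{m₃}, (𝒜^*-zI) ⊗ I_{m₃}}` (the diagonal blocks `E₁₁`, `E₂₂`). -/
def diagKronH (n m₃ : ℕ) (z : ℂ) :
    Matrix ((Fin n × Fin m₃) ⊕ (Fin n × Fin m₃)) ((Fin n × Fin m₃) ⊕ (Fin n × Fin m₃)) ℂ :=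
  Matrix.fromBlocks (((calA n)ᴴ - z • 1) ⊗ₖ (1 : Matrix (Fin m₃) (Fin m₃) ℂ)) 0 0
    (((calA n)ᴴ - z • 1) ⊗ₖ (1 : Matrix (Fin m₃) (Fin m₃) ℂ))

/-- `𝔄(z) = diag {(𝒜^*-zI) ⊗ I_{m₃}, (𝒜-zI) ⊗ I_{m₃}}`. -/
def frakA (n m₃ : ℕ) (z : ℂ) :
    Matrix ((Fin n × Fin m₃) ⊕ (Fin n × Fin m₃)) ((Fin n × Fin m₃) ⊕ (Fin n × Fin m₃)) ℂ :=
  Matrix.fromBlocks (((calA n)ᴴ - z • 1) ⊗ₖ (1 : Matrix (Fin m₃) (Fin m₃) ℂ)) 0 0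
    ((calA n - z • 1) ⊗ₖ (1 : Matrix (Fin m₃) (Fin m₃) ℂ))

/-- `G₁₂ = i (Π̂₁ Γ₂ - [[ℒ₂ℒ₁^*, 0], [K₁₂, 0]])`. -/
def G12 (m₁ m₂ m₃ : ℕ) (t : ℤ → ℤ → Matrix (Fin m₃) (Fin m₃) ℂ) :
    Matrix ((Fin m₂ × Fin m₃) ⊕ (Fin m₂ × Fin m₃)) ((Fin m₁ × Fin m₃) ⊕ (Fin m₁ × Fin m₃)) ℂ :=
  Complex.I • (Pihat1 m₁ m₂ m₃ t * Gamma2 m₁ m₂ m₃ t -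
    Matrix.fromBlocks (Lp m₂ m₃ * (Lp m₁ m₃)ᴴ) 0 (K12 m₁ m₂ m₃ t) 0)

/-- `G₂₁ = i (Π̂₂ Γ₁ - [[ℒ₁ℒ₂^*, 0], [K₁₁, 0]])`. -/
def G21 (m₁ m₂ m₃ : ℕ) (t : ℤ → ℤ → Matrix (Fin m₃) (Fin m₃) ℂ) :
    Matrix ((Fin m₁ × Fin m₃) ⊕ (Fin m₁ × Fin m₃)) ((Fin m₂ × Fin m₃) ⊕ (Fin m₂ × Fin m₃)) ℂ :=
  Complex.I • (Pihat2 m₁ m₂ m₃ t * Gamma1 m₁ m₂ m₃ t -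
    Matrix.fromBlocks (Lp m₁ m₃ * (Lp m₂ m₃)ᴴ) 0 (K11 m₁ m₂ m₃ t) 0)

/-- `G(λ) = [[G₁₁(λ₂), G₁₂], [G₂₁, G₂₂(λ₁)]]`. -/
def Gmat (m₁ m₂ m₃ : ℕ) (t : ℤ → ℤ → Matrix (Fin m₃) (Fin m₃) ℂ) (l₁ l₂ : ℂ) :
    Matrix ((((Fin m₂ × Fin m₃) ⊕ (Fin m₂ × Fin m₃))) ⊕ (((Fin m₁ × Fin m₃) ⊕ (Fin m₁ × Fin m₃))))
      ((((Fin m₂ × Fin m₃) ⊕ (Fin m₂ × Fin m₃))) ⊕ (((Fin m₁ × Fin m₃) ⊕ (Fin m₁ × Fin m₃)))) ℂ :=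
  Matrix.fromBlocks (diagKron m₂ m₃ l₂) (G12 m₁ m₂ m₃ t) (G21 m₁ m₂ m₃ t) (diagKron m₁ m₃ l₁)

/-- `E₁₂ = -i (Π̂₁ Γ₂ - [[0, 0], [K₁₂, ℒ₂ℒ₁^*]])`. -/
def E12m (m₁ m₂ m₃ : ℕ) (t : ℤ → ℤ → Matrix (Fin m₃) (Fin m₃) ℂ) :
    Matrix ((Fin m₂ × Fin m₃) ⊕ (Fin m₂ × Fin m₃)) ((Fin m₁ × Fin m₃) ⊕ (Fin m₁ × Fin m₃)) ℂ :=
  (-Complex.I) • (Pihat1 m₁ m₂ m₃ t * Gamma2 m₁ m₂ m₃ t -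
    Matrix.fromBlocks 0 0 (K12 m₁ m₂ m₃ t) (Lp m₂ m₃ * (Lp m₁ m₃)ᴴ))

/-- `E₂₁ = -i (Π̂₂ Γ₁ - [[0, 0], [K₁₁, ℒ₁ℒ₂^*]])`. -/
def E21m (m₁ m₂ m₃ : ℕ) (t : ℤ → ℤ → Matrix (Fin m₃) (Fin m₃) ℂ) :
    Matrix ((Fin m₁ × Fin m₃) ⊕ (Fin m₁ × Fin m₃)) ((Fin m₂ × Fin m₃) ⊕ (Fin m₂ × Fin m₃)) ℂ :=
  (-Complex.I) • (Pihat2 m₁ m₂ m₃ t * Gamma1 m₁ m₂ m₃ t -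
    Matrix.fromBlocks 0 0 (K11 m₁ m₂ m₃ t) (Lp m₁ m₃ * (Lp m₂ m₃)ᴴ))

/-- `E(μ) = [[E₁₁(μ₂), E₁₂], [E₂₁, E₂₂(μ₁)]]`. -/
def Emat (m₁ m₂ m₃ : ℕ) (t : ℤ → ℤ → Matrix (Fin m₃) (Fin m₃) ℂ) (mu₁ mu₂ : ℂ) :
    Matrix ((((Fin m₂ × Fin m₃) ⊕ (Fin m₂ × Fin m₃))) ⊕ (((Fin m₁ × Fin m₃) ⊕ (Fin m₁ × Fin m₃))))
      ((((Fin m₂ × Fin m₃) ⊕ (Fin m₂ × Fin m₃))) ⊕ (((Fin m₁ × Fin m₃) ⊕ (Fin m₁ × Fin m₃)))) ℂ :=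
  Matrix.fromBlocks (diagKronH m₂ m₃ mu₂) (E12m m₁ m₂ m₃ t) (E21m m₁ m₂ m₃ t) (diagKronH m₁ m₃ mu₁)

/-- `θ(λ) = i (I_{m₃} + K R (A₁-λ₁I)⁻¹ (A₂-λ₂I)⁻¹ ℒ)`. -/
def theta (m₁ m₂ m₃ : ℕ) (t : ℤ → ℤ → Matrix (Fin m₃) (Fin m₃) ℂ) (l₁ l₂ : ℂ) :
    Matrix (Fin m₃) (Fin m₃) ℂ :=
  Complex.I • (1 + Kmat m₁ m₂ m₃ t * (Tmat m₁ m₂ m₃ t)⁻¹ *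
    (A1 m₁ m₂ m₃ - l₁ • 1)⁻¹ * (A2 m₁ m₂ m₃ - l₂ • 1)⁻¹ * Lmat m₁ m₂ m₃)

/-- `ϑ(μ) = -i (I_{m₃} + ℒ^* (A₁^*-μ₁I)⁻¹ (A₂^*-μ₂I)⁻¹ R N)`. -/
def vartheta (m₁ m₂ m₃ : ℕ) (t : ℤ → ℤ → Matrix (Fin m₃) (Fin m₃) ℂ) (mu₁ mu₂ : ℂ) :
    Matrix (Fin m₃) (Fin m₃) ℂ :=
  (-Complex.I) • (1 + (Lmat m₁ m₂ m₃)ᴴ * ((A1 m₁ m₂ m₃)ᴴ - mu₁ • 1)⁻¹ *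
    ((A2 m₁ m₂ m₃)ᴴ - mu₂ • 1)⁻¹ * (Tmat m₁ m₂ m₃ t)⁻¹ * Nmat m₁ m₂ m₃ t)

/-- The exchange (anti-diagonal) matrix `U_n = {δ_{n-i-k+1}}`. -/
def Up (n : ℕ) : Matrix (Fin n) (Fin n) ℂ :=
  Matrix.of fun i k => if (i : ℕ) + (k : ℕ) + 1 = n then 1 else 0

/-- `U = U₁ ⊗ U₂ ⊗ U₃`. -/
def Umat (m₁ m₂ m₃ : ℕ) : Matrix (Idx m₁ m₂ m₃) (Idx m₁ m₂ m₃) ℂ :=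
  (Up m₁ ⊗ₖ Up m₂) ⊗ₖ Up m₃

/-- `Ũ_k = [[0, -(U_k ⊗ U₃)], [U_k ⊗ U₃, 0]]`. -/
def Utilde (n m₃ : ℕ) :
    Matrix ((Fin n × Fin m₃) ⊕ (Fin n × Fin m₃)) ((Fin n × Fin m₃) ⊕ (Fin n × Fin m₃)) ℂ :=
  Matrix.fromBlocks 0 (-(Up n ⊗ₖ Up m₃)) (Up n ⊗ₖ Up m₃) 0

/-- The DSTU property: `U₃ t_j^{(r)} U₃ = (t_j^{(r)})ᵀ` for all blocks. -/
def DSTU (m₃ : ℕ) (t : ℤ → ℤ → Matrix (Fin m₃) (Fin m₃) ℂ) : Prop :=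
  ∀ r j : ℤ, Up m₃ * t r j * Up m₃ = (t r j)ᵀ

/-- `q(μ) = ((μ₁-i/2)/(μ₁+i/2))^{m₁} ((μ₂-i/2)/(μ₂+i/2))^{m₂}`. -/
def qfun (m₁ m₂ : ℕ) (mu₁ mu₂ : ℂ) : ℂ :=
  ((mu₁ - Complex.I / 2) / (mu₁ + Complex.I / 2)) ^ m₁ *
    ((mu₂ - Complex.I / 2) / (mu₂ + Complex.I / 2)) ^ m₂

lemma aux_sum (f : ℤ → ℂ) (i k : ℕ) :
    ∑ l ∈ Finset.range i, f ((l : ℤ) - k) + f ((i : ℤ) - k) + ∑ l ∈ Finset.range k, f ((i : ℤ) - l)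
      = ∑ s ∈ Finset.range i, f ((s : ℤ) + 1) + f 0
        + ∑ s ∈ Finset.range k, f (-((s : ℤ) + 1)) := by
  have h1 : ∑ j ∈ Finset.range (i + 1 + k), f ((j : ℤ) - k) =
      ∑ j ∈ Finset.range (k + (i + 1)), f ((j : ℤ) - k) := by rw [add_comm (i + 1) k]
  rw [Finset.sum_range_add _ (i + 1) k, Finset.sum_range_add _ k (i + 1), Finset.sum_range_succ,
    Finset.sum_range_succ' (fun x => f (((k + x : ℕ) : ℤ) - k))] at h1
  rw [← Finset.sum_range_reflect (fun x => f (((i + 1 + x : ℕ) : ℤ) - k)) k,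
    ← Finset.sum_range_reflect (fun x => f ((x : ℤ) - k)) k] at h1
  have e1 : ∑ j ∈ Finset.range k, f (((i + 1 + (k - 1 - j) : ℕ) : ℤ) - k)
      = ∑ l ∈ Finset.range k, f ((i : ℤ) - l) := by
    refine Finset.sum_congr rfl fun j hj => ?_
    have := Finset.mem_range.1 hj
    congr 1; omega
  have e2 : ∑ j ∈ Finset.range k, f (((k - 1 - j : ℕ) : ℤ) - k)
      = ∑ s ∈ Finset.range k, f (-((s : ℤ) + 1)) := by
    refine Finset.sum_congr rfl fun j hj => ?_
    have := Finset.mem_range.1 hj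
    congr 1; omega
  have e3 : ∑ j ∈ Finset.range i, f (((k + (j + 1) : ℕ) : ℤ) - k)
      = ∑ s ∈ Finset.range i, f ((s : ℤ) + 1) := by
    refine Finset.sum_congr rfl fun j hj => ?_
    congr 1; omega
  have e4 : f (((k + 0 : ℕ) : ℤ) - k) = f 0 := by congr 1; omega
  rw [e1, e2, e3, e4] at h1
  rw [h1]; ring

lemma aux_a (n : ℕ) (i : Fin n) (g : ℕ → ℂ) :
    ∑ l : Fin n, aEnt (((i : ℕ) : ℤ) - ((l : ℕ) : ℤ)) * g l
      = Complex.I * (∑ l ∈ Finset.range (i : ℕ), g l + g i / 2) := by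
  rw [Fin.sum_univ_eq_sum_range (fun l => aEnt (((i : ℕ) : ℤ) - (l : ℤ)) * g l) n]
  have hi := i.2
  rw [← Finset.sum_subset (Finset.range_subset_range.2 (Nat.succ_le_of_lt hi)),
    Finset.sum_range_succ]
  · have : ∑ x ∈ Finset.range (i : ℕ), aEnt (((i : ℕ) : ℤ) - (x : ℤ)) * g x
        = ∑ x ∈ Finset.range (i : ℕ), Complex.I * g x := by
      refine Finset.sum_congr rfl fun j hj => ?_
      have := Finset.mem_range.1 hj
      rw [aEnt, if_neg (by omega), if_neg (by omega)]
    rw [this, ← Finset.mul_sum]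
    simp [aEnt]; ring
  · intro x _ hx
    have : ¬ x < (i : ℕ) + 1 := fun h => hx (Finset.mem_range.2 h)
    rw [aEnt, if_pos (by omega), zero_mul]

lemma star_aEnt (r : ℤ) : star (aEnt r) = - aEnt r := by
  unfold aEnt; split_ifs <;> simp [neg_div]

/-- `A₁ T - T A₁^* = i (M₁₁ M₂₁ + M₃₁ M₄₁)` for every block TBT-matrix `T`. -/
theorem statement2 (m₁ m₂ m₃ : ℕ) (hm₁ : 2 ≤ m₁) (hm₂ : 2 ≤ m₂) (hm₃ : 2 ≤ m₃)
    (t : ℤ → ℤ → Matrix (Fin m₃) (Fin m₃) ℂ) :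
    A1 m₁ m₂ m₃ * Tmat m₁ m₂ m₃ t - Tmat m₁ m₂ m₃ t * (A1 m₁ m₂ m₃)ᴴ =
      Complex.I • (M11 m₁ m₂ m₃ t * M21 m₁ m₂ m₃ + M31 m₁ m₂ m₃ * M41 m₁ m₂ m₃ t) := by
  ext ⟨⟨i, p⟩, u⟩ ⟨⟨k, q⟩, v⟩
  have hL1 : (A1 m₁ m₂ m₃ * Tmat m₁ m₂ m₃ t) ((i, p), u) ((k, q), v) =
      ∑ l : Fin m₁, aEnt (((i : ℕ) : ℤ) - ((l : ℕ) : ℤ)) *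
        t (((l : ℕ) : ℤ) - ((k : ℕ) : ℤ)) (((p : ℕ) : ℤ) - ((q : ℕ) : ℤ)) u v := by
    simp [Matrix.mul_apply, A1, Tmat, calA, Fintype.sum_prod_type, Matrix.one_apply]
  have hL2 : (Tmat m₁ m₂ m₃ t * (A1 m₁ m₂ m₃)ᴴ) ((i, p), u) ((k, q), v) =
      - ∑ l : Fin m₁, aEnt (((k : ℕ) : ℤ) - ((l : ℕ) : ℤ)) *
        t (((i : ℕ) : ℤ) - ((l : ℕ) : ℤ)) (((p : ℕ) : ℤ) - ((q : ℕ) : ℤ)) u v := by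
    have hs : ∀ r, (starRingEnd ℂ) (aEnt r) = - aEnt r := star_aEnt
    simp [Matrix.mul_apply, A1, Tmat, calA, Fintype.sum_prod_type, Matrix.one_apply,
      apply_ite, hs, mul_comm]
  have hR1 : (M11 m₁ m₂ m₃ t * M21 m₁ m₂ m₃) ((i, p), u) ((k, q), v) =
      M11 m₁ m₂ m₃ t ((i, p), u) (q, v) := by
    simp [Matrix.mul_apply, M21, Fintype.sum_prod_type, ite_and]
  have hR2 : (M31 m₁ m₂ m₃ * M41 m₁ m₂ m₃ t) ((i, p), u) ((k, q), v) =
      M41 m₁ m₂ m₃ t (p, u) ((k, q), v) := by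
    simp [Matrix.mul_apply, M31, M21, Fintype.sum_prod_type, ite_and, apply_ite]
  have key := aux_sum (fun r => t r (((p : ℕ) : ℤ) - ((q : ℕ) : ℤ)) u v) i k
  rw [Matrix.sub_apply, Matrix.smul_apply, Matrix.add_apply, hL1, hL2, hR1, hR2,
    aux_a m₁ i (fun l => t ((l : ℤ) - ((k : ℕ) : ℤ)) (((p : ℕ) : ℤ) - ((q : ℕ) : ℤ)) u v),
    aux_a m₁ k (fun l => t (((i : ℕ) : ℤ) - (l : ℤ)) (((p : ℕ) : ℤ) - ((q : ℕ) : ℤ)) u v)]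
  simp only [M11, M41, calT, Matrix.of_apply, Matrix.add_apply, Matrix.smul_apply,
    Matrix.sum_apply, smul_eq_mul]
  linear_combination Complex.I * key

end TBT
end
end

section
/- (Proposition 2.1) Let T be an invertible block TBT-matrix, and let λ = (λ₁,λ₂), μ = (μ₁,μ₂) be complex pairs with λ₁,λ₂ ≠ i/2, μ₁,μ₂ ≠ −i/2, and λ_p ≠ μ_p. Then for each p = 1,2 one has ω(λ,μ) = i(λ_p − μ_p)^{−1} u_p(μ) û_p(λ). -/
open Matrix Kronecker BigOperators

noncomputable section

namespace TBT

theorem core {n k p : Type*} [Fintype n] [Fintype k] [Fintype p] [DecidableEq n]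
    (A D T R : Matrix n n ℂ) (hTR : T * R = 1) (hRT : R * T = 1)
    (P : Matrix n k ℂ) (Q : Matrix k n ℂ) (hid : A * T - T * D = Complex.I • (P * Q))
    (B : Matrix p n ℂ) (C : Matrix n p ℂ) (X : Matrix p k ℂ) (Y : Matrix k p ℂ) (l mu : ℂ)
    (hX : X * Q = B * (D - mu • 1)) (hY : P * Y = (A - l • 1) * C) (hXY : X * Y = 0)
    (hne : l ≠ mu) :
    B * R * C = (Complex.I * (l - mu)⁻¹) •
      ((B * (R * P) - Complex.I • X) * (Q * R * C + Complex.I • Y)) := by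
  have hne' : l - mu ≠ 0 := sub_ne_zero.mpr hne
  have h1 : R * P * (Q * R) = (-Complex.I) • (R * A - D * R) := by
    have : P * Q = (-Complex.I) • (A * T - T * D) := by
      rw [hid, smul_smul]; simp
    calc R * P * (Q * R) = R * (P * Q) * R := by simp only [Matrix.mul_assoc]
      _ = (-Complex.I) • (R * A * (T * R) - (R * T) * D * R) := by
        rw [this]
        simp only [Matrix.mul_smul, Matrix.smul_mul, Matrix.mul_sub, Matrix.sub_mul,
          Matrix.mul_assoc]
      _ = _ := by rw [hTR, hRT]; simp
  have h2 : B * (R * P) * (Q * R * C) = (-Complex.I) • (B * R * A * C - B * D * R * C) := by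
    calc B * (R * P) * (Q * R * C) = B * (R * P * (Q * R)) * C := by
          simp only [Matrix.mul_assoc]
      _ = _ := by
        rw [h1]
        simp only [Matrix.mul_smul, Matrix.smul_mul, Matrix.mul_sub, Matrix.sub_mul,
          Matrix.mul_assoc]
  have h3 : B * (R * P) * Y = B * R * A * C - l • (B * R * C) := by
    calc B * (R * P) * Y = B * R * (P * Y) := by simp only [Matrix.mul_assoc]
      _ = _ := by
        rw [hY]
        simp only [Matrix.mul_smul, Matrix.smul_mul, Matrix.mul_sub, Matrix.sub_mul,
          Matrix.mul_assoc, Matrix.one_mul]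
  have h4 : X * (Q * R * C) = B * D * R * C - mu • (B * R * C) := by
    calc X * (Q * R * C) = (X * Q) * R * C := by simp only [Matrix.mul_assoc]
      _ = _ := by
        rw [hX]
        simp only [Matrix.mul_smul, Matrix.smul_mul, Matrix.mul_sub, Matrix.sub_mul,
          Matrix.mul_assoc, Matrix.one_mul, Matrix.mul_one]
  have h5 : (B * (R * P) - Complex.I • X) * (Q * R * C + Complex.I • Y)
      = (-Complex.I * (l - mu)) • (B * R * C) := by
    rw [Matrix.sub_mul, Matrix.mul_add, Matrix.mul_add, Matrix.mul_smul, Matrix.mul_smul,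
      Matrix.smul_mul, Matrix.smul_mul, hXY, h2, h3, h4]
    module
  rw [h5, smul_smul]
  have : Complex.I * (l - mu)⁻¹ * (-Complex.I * (l - mu)) = 1 := by
    field_simp
    simp
  rw [this, one_smul]

theorem sum_aEnt (n j : ℕ) (hj : j < n) (g : ℕ → ℂ) :
    ∑ k : Fin n, aEnt ((j : ℤ) - ((k : ℕ) : ℤ)) * g k
      = Complex.I * ((2 : ℂ)⁻¹ * g j + ∑ k ∈ Finset.range j, g k) := by
  rw [Fin.sum_univ_eq_sum_range (fun k => aEnt ((j : ℤ) - (k : ℤ)) * g k) n]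
  rw [← Finset.sum_subset (s₁ := Finset.range (j + 1))]
  · rw [Finset.sum_range_succ, mul_add, Finset.mul_sum, add_comm]
    congr 1
    · simp [aEnt]; ring
    · apply Finset.sum_congr rfl
      intro k hk
      have := Finset.mem_range.mp hk
      have h1 : ¬ ((j : ℤ) - k < 0) := by omega
      have h2 : ¬ ((j : ℤ) - k = 0) := by omega
      simp only [aEnt, h1, h2, if_false]
  · intro x hx
    simp only [Finset.mem_range] at *
    omega
  · intro x _ hx
    simp only [Finset.mem_range] at *
    have h1 : ((j : ℤ) - x < 0) := by omega
    simp [aEnt, h1]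

theorem sum_aEnt_star (n j : ℕ) (hj : j < n) (g : ℕ → ℂ) :
    ∑ k : Fin n, g k * star (aEnt ((j : ℤ) - ((k : ℕ) : ℤ)))
      = -Complex.I * ((2 : ℂ)⁻¹ * g j + ∑ k ∈ Finset.range j, g k) := by
  have := congrArg star (sum_aEnt n j hj (fun k => star (g k)))
  simp only [star_sum, star_mul, star_star, star_add] at this
  rw [this]
  simp
  ring

theorem tele (f : ℤ → ℂ) (j l : ℕ) :
    f ((j : ℤ) - l) + ∑ k ∈ Finset.range j, f ((k : ℤ) - l) +
      ∑ k ∈ Finset.range l, f ((j : ℤ) - k) =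
    f 0 + ∑ s ∈ Finset.range j, f ((s : ℤ) + 1) + ∑ s ∈ Finset.range l, f (-((s : ℤ) + 1)) := by
  induction j with
  | zero =>
    have h := Finset.sum_range_succ (fun k : ℕ => f (-(k : ℤ))) l
    have h' := Finset.sum_range_succ' (fun k : ℕ => f (-(k : ℤ))) l
    simp at h h' ⊢
    linear_combination h' - h
  | succ j ih =>
    have h := Finset.sum_range_succ (fun k : ℕ => f ((j : ℤ) + 1 - (k : ℤ))) l
    have h' := Finset.sum_range_succ' (fun k : ℕ => f ((j : ℤ) + 1 - (k : ℤ))) l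
    have e : ∀ k : ℕ, (j : ℤ) + 1 - ((k + 1 : ℕ) : ℤ) = j - k := by intro k; push_cast; ring
    simp only [e] at h'
    simp only [Finset.sum_range_succ]
    push_cast at *
    simp only [sub_zero] at h'
    linear_combination ih + h' - h

/-- Displacement identity in one variable. -/
theorem disp (n : ℕ) (f : ℤ → ℂ) (j l : Fin n) :
    ∑ k : Fin n, aEnt (((j : ℕ) : ℤ) - ((k : ℕ) : ℤ)) * f (((k : ℕ) : ℤ) - ((l : ℕ) : ℤ)) -
    ∑ k : Fin n, f (((j : ℕ) : ℤ) - ((k : ℕ) : ℤ)) * star (aEnt (((l : ℕ) : ℤ) - ((k : ℕ) : ℤ))) =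
    Complex.I * (((2 : ℂ)⁻¹ * f 0 + ∑ s ∈ Finset.range (j : ℕ), f ((s : ℤ) + 1)) +
      ((2 : ℂ)⁻¹ * f 0 + ∑ s ∈ Finset.range (l : ℕ), f (-((s : ℤ) + 1)))) := by
  rw [sum_aEnt n j j.2 (fun k => f ((k : ℤ) - ((l : ℕ) : ℤ))),
    sum_aEnt_star n l l.2 (fun k => f (((j : ℕ) : ℤ) - (k : ℤ)))]
  linear_combination Complex.I * tele f j l

theorem A1H (m₁ m₂ m₃ : ℕ) : (A1 m₁ m₂ m₃)ᴴ = ((calA m₁)ᴴ ⊗ₖ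
    (1 : Matrix (Fin m₂) (Fin m₂) ℂ)) ⊗ₖ (1 : Matrix (Fin m₃) (Fin m₃) ℂ) := by
  simp [A1, Matrix.conjTranspose_kronecker]

theorem A2H (m₁ m₂ m₃ : ℕ) : (A2 m₁ m₂ m₃)ᴴ = ((1 : Matrix (Fin m₁) (Fin m₁) ℂ) ⊗ₖ
    (calA m₂)ᴴ) ⊗ₖ (1 : Matrix (Fin m₃) (Fin m₃) ℂ) := by
  simp [A2, Matrix.conjTranspose_kronecker]

theorem M31_eq (m₁ m₂ m₃ : ℕ) : M31 m₁ m₂ m₃ =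
    Matrix.of fun x y => if x.1.2 = y.1 ∧ x.2 = y.2 then 1 else 0 := by
  ext x y
  simp only [M31, M21, Matrix.conjTranspose_apply, Matrix.of_apply, eq_comm]
  split_ifs <;> simp

theorem M32_eq (m₁ m₂ m₃ : ℕ) : M32 m₁ m₂ m₃ =
    Matrix.of fun x y => if x.1.1 = y.1 ∧ x.2 = y.2 then 1 else 0 := by
  ext x y
  simp only [M32, M22, Matrix.conjTranspose_apply, Matrix.of_apply, eq_comm]
  split_ifs <;> simp

theorem LmatH_eq (m₁ m₂ m₃ : ℕ) : (Lmat m₁ m₂ m₃)ᴴ =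
    Matrix.of fun l x => if l = x.2 then 1 else 0 := by
  ext x y
  simp only [Lmat, Matrix.conjTranspose_apply, Matrix.of_apply, eq_comm]
  split_ifs <;> simp

theorem ident1 (m₁ m₂ m₃ : ℕ) (t : ℤ → ℤ → Matrix (Fin m₃) (Fin m₃) ℂ) :
    A1 m₁ m₂ m₃ * Tmat m₁ m₂ m₃ t - Tmat m₁ m₂ m₃ t * (A1 m₁ m₂ m₃)ᴴ =
      Complex.I • (Pi1 m₁ m₂ m₃ t * Pihat1 m₁ m₂ m₃ t) := by
  rw [A1H, Pi1, Pihat1, Matrix.fromCols_mul_fromRows]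
  ext ⟨⟨i, j⟩, a⟩ ⟨⟨k, l⟩, b⟩
  have h := disp m₁ (fun r => t r (((j : ℕ) : ℤ) - ((l : ℕ) : ℤ)) a b) i k
  simp only [Matrix.sub_apply, Matrix.smul_apply, Matrix.add_apply, smul_eq_mul]
  convert h using 2
  · simp [Matrix.mul_apply, A1, Tmat, calA, Fintype.sum_prod_type, Matrix.one_apply]
  · simp [Matrix.mul_apply, A1, Tmat, calA, Fintype.sum_prod_type, Matrix.one_apply]
  · congr 1
    · simp [Matrix.mul_apply, M11, M21, calT, Fintype.sum_prod_type, Matrix.sum_apply, ite_and]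
    · simp [Matrix.mul_apply, M31_eq, M41, M21, calT, Fintype.sum_prod_type, Matrix.sum_apply, ite_and]

theorem ident2 (m₁ m₂ m₃ : ℕ) (t : ℤ → ℤ → Matrix (Fin m₃) (Fin m₃) ℂ) :
    A2 m₁ m₂ m₃ * Tmat m₁ m₂ m₃ t - Tmat m₁ m₂ m₃ t * (A2 m₁ m₂ m₃)ᴴ =
      Complex.I • (Pi2 m₁ m₂ m₃ t * Pihat2 m₁ m₂ m₃ t) := by
  rw [A2H, Pi2, Pihat2, Matrix.fromCols_mul_fromRows]
  ext ⟨⟨i, j⟩, a⟩ ⟨⟨k, l⟩, b⟩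
  have h := disp m₂ (fun r => t (((i : ℕ) : ℤ) - ((k : ℕ) : ℤ)) r a b) j l
  simp only [Matrix.sub_apply, Matrix.smul_apply, Matrix.add_apply, smul_eq_mul]
  convert h using 2
  · simp [Matrix.mul_apply, A2, Tmat, calA, Fintype.sum_prod_type, Matrix.one_apply]
  · simp [Matrix.mul_apply, A2, Tmat, calA, Fintype.sum_prod_type, Matrix.one_apply]
  · congr 1
    · simp [Matrix.mul_apply, M12, M12blk, M22, Fintype.sum_prod_type, Matrix.sum_apply, ite_and]
    · simp [Matrix.mul_apply, M32_eq, M42, M42blk, M22, Fintype.sum_prod_type, Matrix.sum_apply,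
        ite_and]

theorem isUnit_calA (n : ℕ) (z : ℂ) (hz : z ≠ Complex.I / 2) : IsUnit (calA n - z • 1).det := by
  rw [Matrix.det_of_isLowerTriangular]
  · rw [isUnit_iff_ne_zero, Finset.prod_ne_zero_iff]
    intro i _
    simp [calA, aEnt, sub_ne_zero, hz.symm]
  · intro i j hij
    have hij : i < j := by simpa using hij
    have h1 : ((i : ℕ) : ℤ) - ((j : ℕ) : ℤ) < 0 := by
      have : (i : ℕ) < j := hij
      omega
    simp only [Matrix.sub_apply, Matrix.smul_apply, Matrix.one_apply_ne hij.ne, calA, aEnt,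
      Matrix.of_apply, h1]
    simp

theorem isUnit_calAH (n : ℕ) (z : ℂ) (hz : z ≠ -(Complex.I / 2)) :
    IsUnit ((calA n)ᴴ - z • 1).det := by
  have h : (calA n)ᴴ - z • 1 = (calA n - (star z) • 1)ᴴ := by
    simp [Matrix.conjTranspose_sub, Matrix.conjTranspose_smul]
  rw [h, Matrix.det_conjTranspose]
  apply IsUnit.star
  apply isUnit_calA
  intro h'
  apply hz
  have := congrArg star h'
  rw [star_star] at this
  rw [this]
  simp [neg_div]

theorem k1 (m₁ m₂ m₃ : ℕ) (M : Matrix (Fin m₁) (Fin m₁) ℂ) (z : ℂ) :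
    (M ⊗ₖ (1 : Matrix (Fin m₂) (Fin m₂) ℂ)) ⊗ₖ (1 : Matrix (Fin m₃) (Fin m₃) ℂ) - z • 1 =
    ((M - z • 1) ⊗ₖ (1 : Matrix (Fin m₂) (Fin m₂) ℂ)) ⊗ₖ (1 : Matrix (Fin m₃) (Fin m₃) ℂ) := by
  ext ⟨⟨i, j⟩, a⟩ ⟨⟨k, l⟩, b⟩
  simp [Matrix.one_apply, Prod.ext_iff]
  split_ifs <;> simp_all

theorem k2 (m₁ m₂ m₃ : ℕ) (M : Matrix (Fin m₂) (Fin m₂) ℂ) (z : ℂ) :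
    ((1 : Matrix (Fin m₁) (Fin m₁) ℂ) ⊗ₖ M) ⊗ₖ (1 : Matrix (Fin m₃) (Fin m₃) ℂ) - z • 1 =
    ((1 : Matrix (Fin m₁) (Fin m₁) ℂ) ⊗ₖ (M - z • 1)) ⊗ₖ (1 : Matrix (Fin m₃) (Fin m₃) ℂ) := by
  ext ⟨⟨i, j⟩, a⟩ ⟨⟨k, l⟩, b⟩
  simp [Matrix.one_apply, Prod.ext_iff]
  split_ifs <;> simp_all

theorem kk (m₁ m₂ m₃ : ℕ) (P P' : Matrix (Fin m₁) (Fin m₁) ℂ) (Q Q' : Matrix (Fin m₂) (Fin m₂) ℂ) :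
    ((P ⊗ₖ Q) ⊗ₖ (1 : Matrix (Fin m₃) (Fin m₃) ℂ)) * ((P' ⊗ₖ Q') ⊗ₖ 1) =
      ((P * P') ⊗ₖ (Q * Q')) ⊗ₖ (1 : Matrix (Fin m₃) (Fin m₃) ℂ) := by
  rw [← Matrix.mul_kronecker_mul, ← Matrix.mul_kronecker_mul, Matrix.one_mul]

theorem row1 (m₁ m₂ m₃ : ℕ) (Q : Matrix (Fin m₂) (Fin m₂) ℂ) :
    rowKronId m₃ (Matrix.vecMul (fun _ : Fin m₂ => (1 : ℂ)) Q) * M21 m₁ m₂ m₃ =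
      (Lmat m₁ m₂ m₃)ᴴ * (((1 : Matrix (Fin m₁) (Fin m₁) ℂ) ⊗ₖ Q) ⊗ₖ (1 : Matrix (Fin m₃) (Fin m₃) ℂ)) := by
  ext a ⟨⟨k, l⟩, b⟩
  simp [Matrix.mul_apply, rowKronId, M21, Lmat, LmatH_eq, Fintype.sum_prod_type, Matrix.one_apply, ite_and,
    Matrix.vecMul, dotProduct]
  simp only [eq_comm]

theorem row2 (m₁ m₂ m₃ : ℕ) (Q : Matrix (Fin m₁) (Fin m₁) ℂ) :
    rowKronId m₃ (Matrix.vecMul (fun _ : Fin m₁ => (1 : ℂ)) Q) * M22 m₁ m₂ m₃ =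
      (Lmat m₁ m₂ m₃)ᴴ * ((Q ⊗ₖ (1 : Matrix (Fin m₂) (Fin m₂) ℂ)) ⊗ₖ (1 : Matrix (Fin m₃) (Fin m₃) ℂ)) := by
  ext a ⟨⟨k, l⟩, b⟩
  simp [Matrix.mul_apply, rowKronId, M22, Lmat, LmatH_eq, Fintype.sum_prod_type, Matrix.one_apply, ite_and,
    Matrix.vecMul, dotProduct]
  simp only [eq_comm]

theorem col1 (m₁ m₂ m₃ : ℕ) (Q : Matrix (Fin m₂) (Fin m₂) ℂ) :
    M31 m₁ m₂ m₃ * colKronId m₃ (Matrix.mulVec Q (fun _ : Fin m₂ => (1 : ℂ))) =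
      (((1 : Matrix (Fin m₁) (Fin m₁) ℂ) ⊗ₖ Q) ⊗ₖ (1 : Matrix (Fin m₃) (Fin m₃) ℂ)) * Lmat m₁ m₂ m₃ := by
  ext ⟨⟨k, l⟩, b⟩ a
  simp [Matrix.mul_apply, colKronId,  Lmat, LmatH_eq, Fintype.sum_prod_type, Matrix.one_apply,
    ite_and, Matrix.mulVec, dotProduct, M31_eq, M32_eq]

theorem col2 (m₁ m₂ m₃ : ℕ) (Q : Matrix (Fin m₁) (Fin m₁) ℂ) :
    M32 m₁ m₂ m₃ * colKronId m₃ (Matrix.mulVec Q (fun _ : Fin m₁ => (1 : ℂ))) =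
      ((Q ⊗ₖ (1 : Matrix (Fin m₂) (Fin m₂) ℂ)) ⊗ₖ (1 : Matrix (Fin m₃) (Fin m₃) ℂ)) * Lmat m₁ m₂ m₃ := by
  ext ⟨⟨k, l⟩, b⟩ a
  simp [Matrix.mul_apply, colKronId,  Lmat, LmatH_eq, Fintype.sum_prod_type, Matrix.one_apply,
    ite_and, Matrix.mulVec, dotProduct, M31_eq, M32_eq]

/-- Proposition 2.1: `ω(λ,μ) = i (λ_p - μ_p)⁻¹ u_p(μ) û_p(λ)` for `p = 1, 2`. -/
theorem statement4 (m₁ m₂ m₃ : ℕ) (hm₁ : 2 ≤ m₁) (hm₂ : 2 ≤ m₂) (hm₃ : 2 ≤ m₃)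
    (t : ℤ → ℤ → Matrix (Fin m₃) (Fin m₃) ℂ) (hT : IsUnit (Tmat m₁ m₂ m₃ t))
    (l₁ l₂ mu₁ mu₂ : ℂ)
    (hl₁ : l₁ ≠ Complex.I / 2) (hl₂ : l₂ ≠ Complex.I / 2)
    (hmu₁ : mu₁ ≠ -(Complex.I / 2)) (hmu₂ : mu₂ ≠ -(Complex.I / 2))
    (hne₁ : l₁ ≠ mu₁) (hne₂ : l₂ ≠ mu₂) :
    omegaF m₁ m₂ m₃ t l₁ l₂ mu₁ mu₂ =
      (Complex.I * (l₁ - mu₁)⁻¹) • (u1 m₁ m₂ m₃ t mu₁ mu₂ * uhat1 m₁ m₂ m₃ t l₁ l₂) ∧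
    omegaF m₁ m₂ m₃ t l₁ l₂ mu₁ mu₂ =
      (Complex.I * (l₂ - mu₂)⁻¹) • (u2 m₁ m₂ m₃ t mu₁ mu₂ * uhat2 m₁ m₂ m₃ t l₁ l₂) := by
  have hdet : IsUnit (Tmat m₁ m₂ m₃ t).det := (Matrix.isUnit_iff_isUnit_det _).mp hT
  have hTR := Matrix.mul_nonsing_inv _ hdet
  have hRT := Matrix.nonsing_inv_mul _ hdet
  have uA1 := isUnit_calA m₁ l₁ hl₁
  have uA2 := isUnit_calA m₂ l₂ hl₂
  have uB1 := isUnit_calAH m₁ mu₁ hmu₁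
  have uB2 := isUnit_calAH m₂ mu₂ hmu₂
  have eA1 : A1 m₁ m₂ m₃ - l₁ • 1 = ((calA m₁ - l₁ • 1) ⊗ₖ 1) ⊗ₖ 1 := k1 _ _ _ _ _
  have eA2 : A2 m₁ m₂ m₃ - l₂ • 1 = (1 ⊗ₖ (calA m₂ - l₂ • 1)) ⊗ₖ 1 := k2 _ _ _ _ _
  have eB1 : (A1 m₁ m₂ m₃)ᴴ - mu₁ • 1 = (((calA m₁)ᴴ - mu₁ • 1) ⊗ₖ 1) ⊗ₖ 1 := by
    rw [A1H]; exact k1 _ _ _ _ _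
  have eB2 : (A2 m₁ m₂ m₃)ᴴ - mu₂ • 1 = (1 ⊗ₖ ((calA m₂)ᴴ - mu₂ • 1)) ⊗ₖ 1 := by
    rw [A2H]; exact k2 _ _ _ _ _
  have eC : (A1 m₁ m₂ m₃ - l₁ • 1)⁻¹ * (A2 m₁ m₂ m₃ - l₂ • 1)⁻¹ =
      ((calA m₁ - l₁ • 1)⁻¹ ⊗ₖ (calA m₂ - l₂ • 1)⁻¹) ⊗ₖ 1 := by
    rw [eA1, eA2]
    simp only [Matrix.inv_kronecker, inv_one]
    rw [kk, Matrix.one_mul, Matrix.mul_one]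
  have eB : ((A1 m₁ m₂ m₃)ᴴ - mu₁ • 1)⁻¹ * ((A2 m₁ m₂ m₃)ᴴ - mu₂ • 1)⁻¹ =
      (((calA m₁)ᴴ - mu₁ • 1)⁻¹ ⊗ₖ ((calA m₂)ᴴ - mu₂ • 1)⁻¹) ⊗ₖ 1 := by
    rw [eB1, eB2]
    simp only [Matrix.inv_kronecker, inv_one]
    rw [kk, Matrix.one_mul, Matrix.mul_one]
  constructor
  · have h := core (A1 m₁ m₂ m₃) (A1 m₁ m₂ m₃)ᴴ _ _ hTR hRT _ _ (ident1 m₁ m₂ m₃ t)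
      ((Lmat m₁ m₂ m₃)ᴴ * (((A1 m₁ m₂ m₃)ᴴ - mu₁ • 1)⁻¹ * ((A2 m₁ m₂ m₃)ᴴ - mu₂ • 1)⁻¹))
      (((A1 m₁ m₂ m₃ - l₁ • 1)⁻¹ * (A2 m₁ m₂ m₃ - l₂ • 1)⁻¹) * Lmat m₁ m₂ m₃)
      (Matrix.fromCols (rowKronId m₃ (Matrix.vecMul (fun _ : Fin m₂ => (1 : ℂ))
        (((calA m₂)ᴴ - mu₂ • 1)⁻¹))) 0)
      (Matrix.fromRows 0
        (colKronId m₃ (Matrix.mulVec ((calA m₂ - l₂ • 1)⁻¹) (fun _ : Fin m₂ => (1 : ℂ)))))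
      l₁ mu₁ ?_ ?_ ?_ hne₁
    · simpa only [omegaF, u1, uhat1, v1, vhat1, Gamma1, Gammahat1, Matrix.mul_assoc] using h
    · rw [Pihat1, Matrix.fromCols_mul_fromRows, Matrix.zero_mul, add_zero, row1, eB, eB1,
        Matrix.mul_assoc, kk, Matrix.nonsing_inv_mul _ uB1, Matrix.mul_one]
    · rw [Pi1, Matrix.fromCols_mul_fromRows, Matrix.mul_zero, zero_add, col1, eC, eA1,
        ← Matrix.mul_assoc, kk, Matrix.mul_nonsing_inv _ uA1, Matrix.one_mul]
    · rw [Matrix.fromCols_mul_fromRows, Matrix.mul_zero, Matrix.zero_mul, add_zero]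
  · have h := core (A2 m₁ m₂ m₃) (A2 m₁ m₂ m₃)ᴴ _ _ hTR hRT _ _ (ident2 m₁ m₂ m₃ t)
      ((Lmat m₁ m₂ m₃)ᴴ * (((A1 m₁ m₂ m₃)ᴴ - mu₁ • 1)⁻¹ * ((A2 m₁ m₂ m₃)ᴴ - mu₂ • 1)⁻¹))
      (((A1 m₁ m₂ m₃ - l₁ • 1)⁻¹ * (A2 m₁ m₂ m₃ - l₂ • 1)⁻¹) * Lmat m₁ m₂ m₃)
      (Matrix.fromCols (rowKronId m₃ (Matrix.vecMul (fun _ : Fin m₁ => (1 : ℂ))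
        (((calA m₁)ᴴ - mu₁ • 1)⁻¹))) 0)
      (Matrix.fromRows 0
        (colKronId m₃ (Matrix.mulVec ((calA m₁ - l₁ • 1)⁻¹) (fun _ : Fin m₁ => (1 : ℂ)))))
      l₂ mu₂ ?_ ?_ ?_ hne₂
    · simpa only [omegaF, u2, uhat2, v2, vhat2, Gamma2, Gammahat2, Matrix.mul_assoc] using h
    · rw [Pihat2, Matrix.fromCols_mul_fromRows, Matrix.zero_mul, add_zero, row2, eB, eB2,
        Matrix.mul_assoc, kk, Matrix.nonsing_inv_mul _ uB2, Matrix.mul_one]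
    · rw [Pi2, Matrix.fromCols_mul_fromRows, Matrix.mul_zero, zero_add, col2, eC, eA2,
        ← Matrix.mul_assoc, kk, Matrix.mul_nonsing_inv _ uA2, Matrix.one_mul]
    · rw [Matrix.fromCols_mul_fromRows, Matrix.mul_zero, Matrix.zero_mul, add_zero]

end TBT
end
end
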